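/- arXiv:1110.1423 — 2 statements merged into one kernel-verified Lean document; each statement's English description precedes it below -/
import Mathlib

section
/- The planar vortex solution is unique: if (v_1,…,v_l) and (ṽ_1,…,ṽ_l) are both planar vortex solutions for the same data, then v_j = ṽ_j for every j = 1,…,l. -/
open MeasureTheory Real Set Filter

noncomputable section

/-- The plane `ℝ²` with the Euclidean norm. -/
abbrev E2 := EuclideanSpace ℝ (Fin 2)

/-- The Laplacian of a function `f : ℝ² → ℝ`, as the sum of its second partial
derivatives in the coordinate directions. -/
noncomputable def lap (f : E2 → ℝ) (x : E2) : ℝ :=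
  ∑ i : Fin 2,
    fderiv ℝ (fun y => fderiv ℝ f y (EuclideanSpace.single i 1)) x (EuclideanSpace.single i 1)

/-- Vortex data for the planar problem: a parameter `μ > 0` and, for each `j = 1, …, l`,
`N j` points `p j k` in the plane (repetitions allowed). -/
structure PlanarVortexData (l : ℕ) where
  μ : ℝ
  μ_pos : 0 < μ
  N : Fin l → ℕ
  p : ∀ j : Fin l, Fin (N j) → E2

namespace PlanarVortexData

variable {l : ℕ} (D : PlanarVortexData l)

/-- `f_j(x) = Π_{k=1}^{N_j} ‖x − p_{j,k}‖²/(μ + ‖x − p_{j,k}‖²)`. -/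
def f (j : Fin l) (x : E2) : ℝ :=
  ∏ k, ‖x - D.p j k‖ ^ 2 / (D.μ + ‖x - D.p j k‖ ^ 2)

/-- `g_j(x) = Σ_{k=1}^{N_j} 4μ/(μ + ‖x − p_{j,k}‖²)²`. -/
def g (j : Fin l) (x : E2) : ℝ :=
  ∑ k, 4 * D.μ / (D.μ + ‖x - D.p j k‖ ^ 2) ^ 2

end PlanarVortexData

/-- `(v_1, …, v_l)` is a planar vortex solution for the data `D`: each `v_j` is `C²`,
solves `Δ v_j = f_j e^{v_j} + Σ_i f_i e^{v_i} − (l+1) + g_j` on `ℝ²`, and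
`v_j(x) → 0` as `‖x‖ → ∞`. -/
def IsPlanarVortexSolution {l : ℕ} (D : PlanarVortexData l) (v : Fin l → E2 → ℝ) : Prop :=
  ∀ j : Fin l,
    ContDiff ℝ 2 (v j) ∧
    (∀ x : E2, lap (v j) x =
      D.f j x * Real.exp (v j x) + ∑ i, D.f i x * Real.exp (v i x) - (l + 1) + D.g j x) ∧
    Tendsto (v j) (cocompact E2) (nhds 0)

/-- Second-order necessary condition at a local maximum in one variable. -/
lemma second_deriv_nonpos_of_isLocalMax {φ φ' : ℝ → ℝ} {c : ℝ}
    (h1 : ∀ t, HasDerivAt φ (φ' t) t) (h2 : HasDerivAt φ' c 0) (hm : IsLocalMax φ 0) :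
    c ≤ 0 := by
  by_contra hc
  push Not at hc
  have hd : deriv φ = φ' := funext fun t => (h1 t).deriv
  have h0 : φ' 0 = 0 := hm.hasDerivAt_eq_zero (h1 0)
  have hmin : IsLocalMin φ 0 := by
    apply isLocalMin_of_deriv_deriv_pos
    · rw [hd, h2.deriv]; exact hc
    · rw [hd, h0]
    · exact (h1 0).continuousAt
  have hconst : φ =ᶠ[nhds 0] fun _ => φ 0 := by
    filter_upwards [hm, hmin] with t ht ht'
    exact le_antisymm ht ht'
  have hd0 : φ' =ᶠ[nhds 0] fun _ => (0 : ℝ) := by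
    have := hconst.deriv
    rw [hd] at this
    simpa using this
  have : c = 0 := h2.unique ((hasDerivAt_const (0 : ℝ) (0 : ℝ)).congr_of_eventuallyEq hd0)
  linarith

lemma line_hasDerivAt (x e : E2) (t : ℝ) : HasDerivAt (fun s : ℝ => x + s • e) e t := by
  simpa using ((hasDerivAt_id t).smul_const e).const_add x

lemma line_first {u : E2 → ℝ} (hu : ContDiff ℝ 2 u) (x e : E2) (t : ℝ) :
    HasDerivAt (fun s : ℝ => u (x + s • e)) (fderiv ℝ u (x + t • e) e) t :=
  ((hu.differentiable (by norm_num)) (x + t • e)).hasFDerivAt.comp_hasDerivAt t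
    (line_hasDerivAt x e t)

lemma line_second {u : E2 → ℝ} (hu : ContDiff ℝ 2 u) (x e : E2) :
    HasDerivAt (fun s : ℝ => fderiv ℝ u (x + s • e) e)
      (fderiv ℝ (fun y => fderiv ℝ u y e) x e) 0 := by
  have h1 : ContDiff ℝ 1 (fderiv ℝ u) := hu.fderiv_right (by norm_num)
  have h2 : Differentiable ℝ (fun y => fderiv ℝ u y e) :=
    (h1.differentiable (by norm_num)).clm_apply (differentiable_const e)
  have h3 := (h2 (x + (0 : ℝ) • e)).hasFDerivAt.comp_hasDerivAt (0 : ℝ) (line_hasDerivAt x e 0)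
  simp only [zero_smul, add_zero] at h3
  exact h3

/-- The quadratic form `(l+1) Σ u_j² - (Σ u_j)²`. -/
def quadQ {l : ℕ} (u : Fin l → ℝ) : ℝ := (l + 1) * ∑ j, u j ^ 2 - (∑ j, u j) ^ 2

lemma quadQ_ge {l : ℕ} (u : Fin l → ℝ) : ∑ j, u j ^ 2 ≤ quadQ u := by
  have := sq_sum_le_card_mul_sum_sq (s := Finset.univ) (f := u)
  simp only [Finset.card_univ, Fintype.card_fin] at this
  unfold quadQ
  linarith

lemma quadQ_nonneg {l : ℕ} (u : Fin l → ℝ) : 0 ≤ quadQ u :=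
  (Finset.sum_nonneg fun j _ => sq_nonneg (u j)).trans (quadQ_ge u)

/-- Second-order condition in direction `e` at a local maximum of `Q(u) + ε ‖x‖²`. -/
lemma dir_ineq {l : ℕ} (u : Fin l → E2 → ℝ) (hu : ∀ j, ContDiff ℝ 2 (u j)) (ε : ℝ) (x e : E2)
    (he : ‖e‖ = 1)
    (hm : IsLocalMax (fun y => quadQ (fun j => u j y) + ε * ‖y‖ ^ 2) x) :
    (l + 1) * ∑ j, u j x * fderiv ℝ (fun y => fderiv ℝ (u j) y e) x e
      - (∑ j, u j x) * (∑ j, fderiv ℝ (fun y => fderiv ℝ (u j) y e) x e) + ε ≤ 0 := by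
  set a : Fin l → ℝ → ℝ := fun j s => u j (x + s • e) with ha
  set b : Fin l → ℝ → ℝ := fun j s => fderiv ℝ (u j) (x + s • e) e with hb
  set c : Fin l → ℝ := fun j => fderiv ℝ (fun y => fderiv ℝ (u j) y e) x e with hc
  have hab : ∀ j t, HasDerivAt (a j) (b j t) t := fun j t => line_first (hu j) x e t
  have hbc : ∀ j, HasDerivAt (b j) (c j) 0 := fun j => line_second (hu j) x e
  have hnorm : ∀ t : ℝ, ‖x + t • e‖ ^ 2 = ‖x‖ ^ 2 + 2 * t * inner ℝ x e + t ^ 2 := by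
    intro t
    rw [norm_add_sq_real, inner_smul_right, norm_smul, he]
    simp
    ring
  set k : ℝ := inner ℝ x e with hk
  have hcont : ContinuousAt (fun s : ℝ => x + s • e) 0 := (line_hasDerivAt x e 0).continuousAt
  have hm' : IsLocalMax (fun s : ℝ => quadQ (fun j => a j s)
      + ε * (‖x‖ ^ 2 + 2 * s * k + s ^ 2)) 0 := by
    have hx : x = x + (0 : ℝ) • e := by simp
    have hm2 := hm
    rw [hx] at hm2
    have := IsLocalMax.comp_continuous (g := fun s : ℝ => x + s • e) (b := 0) hm2 hcont
    simpa [Function.comp_def, hnorm] using this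
  have h1 : ∀ t, HasDerivAt (fun s : ℝ => quadQ (fun j => a j s)
      + ε * (‖x‖ ^ 2 + 2 * s * k + s ^ 2))
      ((l + 1) * ∑ j, 2 * (a j t * b j t) - 2 * ((∑ j, a j t) * (∑ j, b j t))
        + ε * (2 * k + 2 * t)) t := by
    intro t
    unfold quadQ
    have hS : HasDerivAt (fun s => ∑ j, a j s) (∑ j, b j t) t :=
      HasDerivAt.fun_sum fun j _ => hab j t
    have hT : HasDerivAt (fun s => ∑ j, a j s ^ 2) (∑ j, 2 * (a j t * b j t)) t :=
      HasDerivAt.fun_sum fun j _ => by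
        refine ((hab j t).fun_pow 2).congr_deriv ?_
        push_cast; ring
    have hP : HasDerivAt (fun s : ℝ => ‖x‖ ^ 2 + 2 * s * k + s ^ 2) (2 * k + 2 * t) t := by
      refine (((((hasDerivAt_id t).const_mul 2).mul_const k).const_add (‖x‖ ^ 2)).add
        ((hasDerivAt_id t).fun_pow 2)).congr_deriv ?_
      simp
    refine (((hT.const_mul ((l : ℝ) + 1)).sub (hS.fun_pow 2)).add
      (hP.const_mul ε)).congr_deriv ?_
    push_cast; ring
  have h2 : HasDerivAt (fun t => (l + 1) * ∑ j, 2 * (a j t * b j t)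
        - 2 * ((∑ j, a j t) * (∑ j, b j t)) + ε * (2 * k + 2 * t))
      ((l + 1) * ∑ j, 2 * (b j 0 * b j 0 + a j 0 * c j)
        - 2 * ((∑ j, b j 0) * (∑ j, b j 0) + (∑ j, a j 0) * (∑ j, c j)) + ε * 2) 0 := by
    have hS : HasDerivAt (fun s => ∑ j, a j s) (∑ j, b j 0) 0 :=
      HasDerivAt.fun_sum fun j _ => hab j 0
    have hS' : HasDerivAt (fun s => ∑ j, b j s) (∑ j, c j) 0 :=
      HasDerivAt.fun_sum fun j _ => hbc j
    have hT : HasDerivAt (fun s => ∑ j, 2 * (a j s * b j s))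
        (∑ j, 2 * (b j 0 * b j 0 + a j 0 * c j)) 0 :=
      HasDerivAt.fun_sum fun j _ => ((hab j 0).mul (hbc j)).const_mul 2
    have hP : HasDerivAt (fun s : ℝ => 2 * k + 2 * s) 2 0 := by
      simpa using ((hasDerivAt_id (0 : ℝ)).const_mul 2).const_add (2 * k)
    exact ((hT.const_mul _).sub ((hS.mul hS').const_mul 2)).add (hP.const_mul ε)
  have h3 := second_deriv_nonpos_of_isLocalMax h1 h2 hm'
  have h4 := quadQ_nonneg (fun j => b j 0)
  unfold quadQ at h4
  have ha0 : ∀ j, a j 0 = u j x := fun j => by simp [ha]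
  simp only [ha0, ← Finset.mul_sum, Finset.sum_add_distrib, ← pow_two] at h3
  nlinarith [h3, h4]

lemma f_nonneg' {l : ℕ} (D : PlanarVortexData l) (j : Fin l) (x : E2) : 0 ≤ D.f j x := by
  unfold PlanarVortexData.f
  have := D.μ_pos
  exact Finset.prod_nonneg fun k _ => by positivity

lemma lap_sub' {f g : E2 → ℝ} (hf : ContDiff ℝ 2 f) (hg : ContDiff ℝ 2 g) (x : E2) :
    lap (fun y => f y - g y) x = lap f x - lap g x := by
  unfold lap
  rw [← Finset.sum_sub_distrib]
  refine Finset.sum_congr rfl fun i _ => ?_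
  have hs : ContDiff ℝ 2 (fun y => f y - g y) := hf.sub hg
  set e : E2 := EuclideanSpace.single i 1
  have h1 := line_second hs x e
  have h2 := (line_second hf x e).sub (line_second hg x e)
  refine h1.unique (h2.congr_of_eventuallyEq (Eventually.of_forall fun s => ?_))
  exact (line_first hs x e s).unique ((line_first hf x e s).sub (line_first hg x e s))

/-- Maximum principle for the quadratic form. -/
lemma max_principle {l : ℕ} (u : Fin l → E2 → ℝ) (hu : ∀ j, ContDiff ℝ 2 (u j))
    (h0 : ∀ j, Tendsto (u j) (cocompact E2) (nhds 0))
    (hL : ∀ x, 0 ≤ (l + 1) * ∑ j, u j x * lap (u j) x - (∑ j, u j x) * ∑ j, lap (u j) x)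
    (x₀ : E2) : quadQ (fun j => u j x₀) ≤ 0 := by
  by_contra hneg
  push Not at hneg
  set q : E2 → ℝ := fun y => quadQ (fun j => u j y) with hq
  set δ := q x₀ with hδ
  have hδ0 : 0 < δ := hneg
  have hqt : Tendsto q (cocompact E2) (nhds 0) := by
    have : Tendsto q (cocompact E2) (nhds (((l : ℝ) + 1) * ∑ _j : Fin l, (0 : ℝ) ^ 2
        - (∑ _j : Fin l, (0 : ℝ)) ^ 2)) := by
      apply Tendsto.sub
      · exact (tendsto_finsetSum _ fun j _ => (h0 j).pow 2).const_mul _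
      · exact (tendsto_finsetSum _ fun j _ => h0 j).pow 2
    simpa using this
  have hqc : Continuous q := by
    have := fun j => (hu j).continuous
    simp only [hq, quadQ]
    fun_prop
  have hev : ∀ᶠ y in cocompact E2, q y < δ / 2 := hqt.eventually_lt_const (by linarith)
  obtain ⟨R, hR⟩ := Metric.closedBall_compl_subset_of_mem_cocompact hev (0 : E2)
  set r : ℝ := max (max R ‖x₀‖) 0 + 1 with hr
  have hr0 : 0 < r := by positivity
  have hrR : R < r := by
    have := le_max_left (max R ‖x₀‖) 0
    have := le_max_left R ‖x₀‖
    linarith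
  have hrx : ‖x₀‖ < r := by
    have := le_max_left (max R ‖x₀‖) 0
    have := le_max_right R ‖x₀‖
    linarith
  set ε : ℝ := δ / (2 * r ^ 2) with hε
  have hε0 : 0 < ε := by positivity
  have hεr : ε * r ^ 2 = δ / 2 := by rw [hε]; field_simp
  set Φ : E2 → ℝ := fun y => q y + ε * ‖y‖ ^ 2 with hΦ
  have hΦc : Continuous Φ := by fun_prop
  obtain ⟨x, hx, hmax⟩ := (isCompact_closedBall (0 : E2) r).exists_isMaxOn
    ⟨0, by simp [hr0.le]⟩ hΦc.continuousOn
  have hxr : ‖x‖ < r := by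
    by_contra hge
    push Not at hge
    have hle : ‖x‖ ≤ r := by simpa using hx
    have heq : ‖x‖ = r := le_antisymm hle hge
    have hqx : q x < δ / 2 := hR (by simp [heq, hrR])
    have h1 : Φ x₀ ≤ Φ x := hmax (by simpa using hrx.le)
    have h2 : 0 ≤ ε * ‖x₀‖ ^ 2 := by positivity
    simp only [hΦ, heq, hεr] at h1
    linarith
  have hloc : IsLocalMax Φ x := by
    apply hmax.isLocalMax
    exact Filter.mem_of_superset (Metric.isOpen_ball.mem_nhds (by simpa using hxr))
      Metric.ball_subset_closedBall
  have hd := fun i : Fin 2 => dir_ineq u hu ε x (EuclideanSpace.single i 1) (by simp) hloc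
  have hs := Finset.sum_le_sum (s := Finset.univ) fun i _ => hd i
  have hLx := hL x
  simp only [lap, Fin.sum_univ_two, mul_add, Finset.sum_add_distrib] at hLx hs
  linarith

/-- the planar vortex solution for fixed data is unique. -/
theorem uniqueness_of_planar_vortex_solution {l : ℕ} (hl : 2 ≤ l)
    (D : PlanarVortexData l) (v w : Fin l → E2 → ℝ)
    (hv : IsPlanarVortexSolution D v) (hw : IsPlanarVortexSolution D w) :
    ∀ j : Fin l, v j = w j := by
  set u : Fin l → E2 → ℝ := fun j y => v j y - w j y with hu
  have key := max_principle u (fun j => (hv j).1.sub (hw j).1)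
    (fun j => by simpa using (hv j).2.2.sub (hw j).2.2) (by
      intro x
      set h : Fin l → ℝ := fun j => D.f j x * (Real.exp (v j x) - Real.exp (w j x)) with hh
      have hlap : ∀ j, lap (u j) x = h j + ∑ i, h i := by
        intro j
        rw [hu, lap_sub' (hv j).1 (hw j).1, (hv j).2.1, (hw j).2.1]
        simp only [hh, mul_sub, Finset.sum_sub_distrib]
        ring
      have hpos : 0 ≤ ∑ j, u j x * h j := by
        refine Finset.sum_nonneg fun j _ => ?_
        have hf := f_nonneg' D j x
        have : 0 ≤ (v j x - w j x) * (Real.exp (v j x) - Real.exp (w j x)) := by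
          rcases le_total (v j x) (w j x) with hle | hle
          · exact mul_nonneg_of_nonpos_of_nonpos (by linarith)
              (by linarith [Real.exp_le_exp.2 hle])
          · exact mul_nonneg (by linarith) (by linarith [Real.exp_le_exp.2 hle])
        have := mul_nonneg hf this
        simp only [hu, hh]
        linarith
      have hl0 : (0 : ℝ) ≤ l := Nat.cast_nonneg l
      simp only [hlap, mul_add, Finset.sum_add_distrib, ← Finset.sum_mul, Finset.sum_const,
        Finset.card_univ, Fintype.card_fin, nsmul_eq_mul]
      nlinarith [mul_nonneg hl0 hpos])
  intro j
  funext x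
  have h1 := (quadQ_ge (fun j => u j x)).trans (key x)
  have h2 := Finset.single_le_sum (f := fun j => u j x ^ 2) (fun i _ => sq_nonneg (u i x))
    (Finset.mem_univ j)
  have h3 : u j x ^ 2 = 0 := le_antisymm (h2.trans h1) (sq_nonneg _)
  have h4 : v j x - w j x = 0 := by simpa using h3
  linarith
end
end

section
/- Let (v_1,…,v_l) be a planar vortex solution and set u_j(x) = ln f_j(x) + v_j(x) (defined for x outside the finite set of points p_{j,k}). Then for every ε ∈ (0,1) there exist constants C(ε) > 0 and R > 0 such that Σ_{i=1}^l u_i(x)² ≤ C(ε) e^{−(1−ε)‖x‖} for all x with ‖x‖ ≥ R. -/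
open MeasureTheory Real Set Filter

noncomputable section

open Topology

/-- `φ` has first derivative `a` and second derivative `b` at `0`. -/
def D2 (φ : ℝ → ℝ) (a b : ℝ) : Prop :=
  ∃ φ' : ℝ → ℝ, (∀ᶠ t in 𝓝 (0 : ℝ), HasDerivAt φ (φ' t) t) ∧ φ' 0 = a ∧ HasDerivAt φ' b 0

lemma D2.add {φ ψ : ℝ → ℝ} {a b c d : ℝ} (h : D2 φ a b) (k : D2 ψ c d) :
    D2 (fun t => φ t + ψ t) (a + c) (b + d) := by
  obtain ⟨p, h1, h2, h3⟩ := h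
  obtain ⟨q, k1, k2, k3⟩ := k
  refine ⟨fun t => p t + q t, ?_, by simp [h2, k2], h3.add k3⟩
  filter_upwards [h1, k1] with t x y using x.add y

lemma D2.const (c : ℝ) : D2 (fun _ => c) 0 0 :=
  ⟨fun _ => 0, Eventually.of_forall fun t => hasDerivAt_const t c, rfl, hasDerivAt_const _ _⟩

lemma D2.sum {ι : Type*} (s : Finset ι) {φ : ι → ℝ → ℝ} {a b : ι → ℝ}
    (h : ∀ i ∈ s, D2 (φ i) (a i) (b i)) :
    D2 (fun t => ∑ i ∈ s, φ i t) (∑ i ∈ s, a i) (∑ i ∈ s, b i) := by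
  classical
  induction s using Finset.induction_on with
  | empty => simpa using D2.const 0
  | insert i s hi ih =>
    simp only [Finset.sum_insert hi]
    exact (h i (by simp)).add (ih fun j hj => h j (by simp [hj]))

lemma D2.comp {φ g g' : ℝ → ℝ} {a b c d : ℝ} (h : D2 φ a b)
    (hg : ∀ᶠ s in 𝓝 (φ 0), HasDerivAt g (g' s) s) (hc : g' (φ 0) = c)
    (hg' : HasDerivAt g' d (φ 0)) :
    D2 (fun t => g (φ t)) (c * a) (d * a ^ 2 + c * b) := by
  obtain ⟨p, h1, h2, h3⟩ := h
  have h0 := h1.self_of_nhds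
  refine ⟨fun t => g' (φ t) * p t, ?_, by simp [hc, h2], ?_⟩
  · filter_upwards [h1, h0.continuousAt.eventually hg] with t x y
    exact y.comp t x
  · have := (HasDerivAt.comp (0 : ℝ) hg' h0).mul h3
    refine this.congr_deriv ?_
    simp only [Function.comp, hc, h2]
    ring

lemma D2.neg {φ : ℝ → ℝ} {a b : ℝ} (h : D2 φ a b) : D2 (fun t => - φ t) (-a) (-b) := by
  obtain ⟨p, h1, h2, h3⟩ := h
  refine ⟨fun t => - p t, ?_, by simp [h2], h3.neg⟩
  filter_upwards [h1] with t x using x.neg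

lemma D2.congr {φ ψ : ℝ → ℝ} {a b c d : ℝ} (h : D2 φ a b) (e : ψ =ᶠ[𝓝 0] φ)
    (ha : a = c) (hb : b = d) : D2 ψ c d := by
  subst ha hb
  obtain ⟨p, h1, h2, h3⟩ := h
  refine ⟨p, ?_, h2, h3⟩
  filter_upwards [h1, e.eventuallyEq_nhds] with t x y
  exact x.congr_of_eventuallyEq y

lemma D2.sq {φ : ℝ → ℝ} {a b : ℝ} (h : D2 φ a b) :
    D2 (fun t => φ t ^ 2) (2 * φ 0 * a) (2 * a ^ 2 + 2 * φ 0 * b) := by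
  refine h.comp (g := fun s => s ^ 2) (g' := fun s => 2 * s) ?_ rfl ?_
  · exact Eventually.of_forall fun s => by simpa using hasDerivAt_pow 2 s
  · simpa using (hasDerivAt_id (φ 0)).const_mul 2

lemma D2.log {φ : ℝ → ℝ} {a b : ℝ} (h : D2 φ a b) (h0 : φ 0 ≠ 0) :
    D2 (fun t => Real.log (φ t)) ((φ 0)⁻¹ * a) (-((φ 0) ^ 2)⁻¹ * a ^ 2 + (φ 0)⁻¹ * b) := by
  refine h.comp (g := Real.log) (g' := fun s => s⁻¹) ?_ rfl (hasDerivAt_inv h0)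
  filter_upwards [isOpen_ne.mem_nhds h0] with s hs using Real.hasDerivAt_log hs

lemma D2.expsqrt {φ : ℝ → ℝ} {a b : ℝ} (c : ℝ) (h : D2 φ a b) (h0 : 0 < φ 0) :
    D2 (fun t => Real.exp (-c * √(φ t)))
      (Real.exp (-c * √(φ 0)) * (-c * (1 / (2 * √(φ 0)))) * a)
      (Real.exp (-c * √(φ 0)) * (c ^ 2 / (4 * φ 0) + c / (4 * φ 0 * √(φ 0))) * a ^ 2 +
        Real.exp (-c * √(φ 0)) * (-c * (1 / (2 * √(φ 0)))) * b) := by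
  have key : ∀ s : ℝ, 0 < s → HasDerivAt (fun s => Real.exp (-c * √s))
      (Real.exp (-c * √s) * (-c * (1 / (2 * √s)))) s := fun s hs =>
    ((Real.hasDerivAt_sqrt hs.ne').const_mul (-c)).exp
  refine h.comp (g := fun s => Real.exp (-c * √s))
    (g' := fun s => Real.exp (-c * √s) * (-c * (1 / (2 * √s)))) ?_ rfl ?_
  · filter_upwards [lt_mem_nhds h0] with s hs using key s hs
  · have hs := Real.sqrt_pos.2 h0
    have h1 : HasDerivAt (fun s => (2 * √s)⁻¹) _ (φ 0) :=
      ((Real.hasDerivAt_sqrt h0.ne').const_mul 2).inv (by positivity)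
    have := (key _ h0).mul (h1.const_mul (-c))
    simp only [one_div]
    refine this.congr_deriv ?_
    have e : φ 0 = √(φ 0) ^ 2 := (Real.sq_sqrt h0.le).symm
    generalize √(φ 0) = r at *
    rw [e]
    clear e this h1 key
    field_simp
    ring

lemma D2.nonpos_of_max {φ : ℝ → ℝ} {a b : ℝ} (h : D2 φ a b) (hm : IsLocalMax φ 0) : b ≤ 0 := by
  obtain ⟨p, h1, h2, h3⟩ := h
  by_contra! hb
  have hd : deriv φ =ᶠ[𝓝 0] p := by
    filter_upwards [h1] with t ht using ht.deriv
  have hdd : deriv (deriv φ) 0 = b := by rw [hd.deriv_eq]; exact h3.deriv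
  have hmin : IsLocalMin φ 0 := isLocalMin_of_deriv_deriv_pos (by rw [hdd]; exact hb)
    hm.deriv_eq_zero h1.self_of_nhds.continuousAt
  have hc : φ =ᶠ[𝓝 0] fun _ => φ 0 := by
    filter_upwards [hm, hmin] with t x y using le_antisymm x y
  have : deriv (deriv φ) 0 = 0 := by
    rw [hc.deriv.deriv_eq]; simp
  linarith

/-- The unit vectors. -/
abbrev ee (i : Fin 2) : E2 := EuclideanSpace.single i 1

lemma hasDerivAt_line (x : E2) (i : Fin 2) (t : ℝ) :
    HasDerivAt (fun t : ℝ => x + t • ee i) (ee i) t := by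
  simpa using ((hasDerivAt_id t).smul_const (ee i)).const_add x

lemma D2_of_contDiff {v : E2 → ℝ} (hv : ContDiff ℝ 2 v) (x : E2) (i : Fin 2) :
    D2 (fun t => v (x + t • ee i)) (fderiv ℝ v x (ee i))
      (fderiv ℝ (fun y => fderiv ℝ v y (ee i)) x (ee i)) := by
  refine ⟨fun t => fderiv ℝ v (x + t • ee i) (ee i), ?_, by simp, ?_⟩
  · refine Eventually.of_forall fun t => ?_
    have := (hv.differentiable (by norm_num) (x + t • ee i)).hasFDerivAt
    exact this.comp_hasDerivAt t (hasDerivAt_line x i t)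
  · have hd : Differentiable ℝ (fun y => fderiv ℝ v y (ee i)) :=
      ((hv.fderiv_right (m := 1) (by norm_num)).differentiable (by norm_num)).clm_apply
        (differentiable_const _)
    have := (hd (x + (0 : ℝ) • ee i)).hasFDerivAt.comp_hasDerivAt (0 : ℝ) (hasDerivAt_line x i 0)
    rw [zero_smul, add_zero] at this
    exact this

lemma normsq_line (y : E2) (i : Fin 2) (t : ℝ) :
    ‖y + t • ee i‖ ^ 2 = ‖y‖ ^ 2 + 2 * y i * t + t ^ 2 := by
  rw [EuclideanSpace.real_norm_sq_eq, EuclideanSpace.real_norm_sq_eq]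
  fin_cases i <;> simp [Fin.sum_univ_two] <;> ring

lemma D2_normsq (x p : E2) (c : ℝ) (i : Fin 2) :
    D2 (fun t => c + ‖x + t • ee i - p‖ ^ 2) (2 * (x - p) i) 2 := by
  have e : (fun t : ℝ => c + ‖x + t • ee i - p‖ ^ 2) =
      fun t => c + (‖x - p‖ ^ 2 + 2 * (x - p) i * t + t ^ 2) := by
    funext t
    rw [← normsq_line, add_sub_right_comm]
  rw [e]
  refine ⟨fun t => 2 * (x - p) i + 2 * t, Eventually.of_forall fun t => ?_, by simp, ?_⟩
  · have h1 := ((hasDerivAt_id t).const_mul (2 * (x - p) i)).const_add (‖x - p‖ ^ 2)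
    have := (h1.add (hasDerivAt_pow 2 t)).const_add c
    simpa using this
  · simpa using ((hasDerivAt_id (0 : ℝ)).const_mul 2).const_add (2 * (x - p) i)

lemma sum_coord (y : E2) : ∑ i, (y i) ^ 2 = ‖y‖ ^ 2 := (EuclideanSpace.real_norm_sq_eq y).symm

/-- `F` has second-order directional data with Laplacian `L` at `x`. -/
def D2L (F : E2 → ℝ) (x : E2) (a b : Fin 2 → ℝ) : Prop :=
  ∀ i, D2 (fun t => F (x + t • ee i)) (a i) (b i)

lemma log_factor (x p : E2) (m : ℝ) (hm : 0 ≤ m) (hx : x ≠ p) :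
    ∃ a b, D2L (fun y => Real.log (m + ‖y - p‖ ^ 2)) x a b ∧
      ∑ i, b i = 4 * m / (m + ‖x - p‖ ^ 2) ^ 2 := by
  have hq : 0 < ‖x - p‖ := norm_pos_iff.2 (sub_ne_zero.2 hx)
  have hq2 : 0 < m + ‖x - p‖ ^ 2 := by positivity
  have := fun i => (D2_normsq x p m i).log (by simpa using hq2.ne')
  refine ⟨_, _, this, ?_⟩
  simp only [zero_smul, add_zero, mul_pow]
  rw [Finset.sum_add_distrib, ← Finset.mul_sum, ← Finset.mul_sum, sum_coord]
  simp
  field_simp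
  ring

variable {l : ℕ}

lemma f_log (D : PlanarVortexData l) (j : Fin l) {x : E2} (hx : ∀ k, x ≠ D.p j k) :
    Real.log (D.f j x) =
      ∑ k, (Real.log (0 + ‖x - D.p j k‖ ^ 2) + -Real.log (D.μ + ‖x - D.p j k‖ ^ 2)) := by
  have hmu := D.μ_pos
  have hq : ∀ k, 0 < ‖x - D.p j k‖ := fun k => norm_pos_iff.2 (sub_ne_zero.2 (hx k))
  unfold PlanarVortexData.f
  rw [Real.log_prod fun k _ => by have := hq k; positivity]
  refine Finset.sum_congr rfl fun k _ => ?_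
  have := hq k
  rw [Real.log_div (by positivity) (by positivity), zero_add, sub_eq_add_neg]

lemma eventually_line {P : E2 → Prop} {x : E2} (h : ∀ᶠ y in 𝓝 x, P y) (i : Fin 2) :
    ∀ᶠ t in 𝓝 (0 : ℝ), P (x + t • ee i) := by
  have := (hasDerivAt_line x i 0).continuousAt
  have h2 : Tendsto (fun t : ℝ => x + t • ee i) (𝓝 0) (𝓝 x) := by simpa [ContinuousAt] using this
  exact h2.eventually h

lemma eventually_ne_pts (D : PlanarVortexData l) (j : Fin l) {x : E2} (hx : ∀ k, x ≠ D.p j k) :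
    ∀ᶠ y in 𝓝 x, ∀ k, y ≠ D.p j k :=
  eventually_all.2 fun k => isOpen_ne.mem_nhds (hx k)

lemma log_f_D2 (D : PlanarVortexData l) (j : Fin l) {x : E2} (hx : ∀ k, x ≠ D.p j k) :
    ∃ a b, D2L (fun y => Real.log (D.f j y)) x a b ∧ ∑ i, b i = - D.g j x := by
  choose a b hab hb using fun k => log_factor x (D.p j k) 0 le_rfl (hx k)
  choose c d hcd hd using fun k => log_factor x (D.p j k) D.μ D.μ_pos.le (hx k)
  have key : D2L (fun y => ∑ k, (Real.log (0 + ‖y - D.p j k‖ ^ 2) +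
      -Real.log (D.μ + ‖y - D.p j k‖ ^ 2))) x _ _ := fun i =>
    D2.sum Finset.univ fun k _ => (hab k i).add (hcd k i).neg
  refine ⟨_, _, fun i => (key i).congr ?_ rfl rfl, ?_⟩
  · filter_upwards [eventually_line (eventually_ne_pts D j hx) i] with t ht using f_log D j ht
  · rw [Finset.sum_comm]
    simp only [Finset.sum_add_distrib, Finset.sum_neg_distrib, hb, hd]
    simp [PlanarVortexData.g]

lemma f_pos (D : PlanarVortexData l) (j : Fin l) {x : E2} (hx : ∀ k, x ≠ D.p j k) :
    0 < D.f j x := by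
  have hmu := D.μ_pos
  refine Finset.prod_pos fun k _ => ?_
  have : 0 < ‖x - D.p j k‖ := norm_pos_iff.2 (sub_ne_zero.2 (hx k))
  positivity

lemma f_cont (D : PlanarVortexData l) (j : Fin l) : Continuous (D.f j) := by
  have hmu := D.μ_pos
  unfold PlanarVortexData.f
  refine continuous_finset_prod _ fun k _ => ?_
  refine Continuous.div (by fun_prop) (by fun_prop) fun x => by positivity

lemma f_tendsto (D : PlanarVortexData l) (j : Fin l) :
    Tendsto (D.f j) (cocompact E2) (𝓝 1) := by
  have hmu := D.μ_pos
  have : Tendsto (D.f j) (cocompact E2) (𝓝 (∏ k : Fin (D.N j), (1 : ℝ))) := by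
    unfold PlanarVortexData.f
    refine tendsto_finset_prod _ fun k _ => ?_
    have h1 : Tendsto (fun x : E2 => ‖x - D.p j k‖) (cocompact E2) atTop := by
      have h2 : Tendsto (fun x : E2 => ‖x‖ - ‖D.p j k‖) (cocompact E2) atTop :=
        tendsto_atTop_add_const_right _ _ (tendsto_norm_cocompact_atTop (E := E2))
      exact tendsto_atTop_mono (fun x => norm_sub_norm_le _ _) h2
    have h3 : Tendsto (fun x : E2 => D.μ + ‖x - D.p j k‖ ^ 2) (cocompact E2) atTop :=
      tendsto_atTop_add_const_left _ _ ((tendsto_pow_atTop two_ne_zero).comp h1)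
    have h4 : Tendsto (fun x : E2 => 1 - D.μ * (D.μ + ‖x - D.p j k‖ ^ 2)⁻¹) (cocompact E2)
        (𝓝 (1 - D.μ * 0)) := (h3.inv_tendsto_atTop.const_mul D.μ).const_sub 1
    rw [mul_zero, sub_zero] at h4
    refine h4.congr fun x => ?_
    have : 0 < D.μ + ‖x - D.p j k‖ ^ 2 := by positivity
    field_simp
    ring
  simpa using this

lemma alg_ineq (u : Fin l → ℝ) (hu : ∀ j, |u j| ≤ 1 / (2 * (l + 1))) :
    (1 / 2) * ∑ j, u j ^ 2 ≤
      ∑ j, u j * (Real.exp (u j) + ∑ i, Real.exp (u i) - (l + 1)) := by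
  set δ : ℝ := 1 / (2 * (l + 1)) with hδ
  have hδ0 : 0 < δ := by positivity
  have hδ2 : (l + 1) * δ = 1 / 2 := by rw [hδ]; field_simp
  have hδ1 : δ ≤ 1 := by
    have : (0 : ℝ) ≤ l := by positivity
    nlinarith
  set r : Fin l → ℝ := fun j => Real.exp (u j) - 1 - u j with hr
  have hrb : ∀ j, |r j| ≤ u j ^ 2 := fun j =>
    Real.abs_exp_sub_one_sub_id_le ((hu j).trans hδ1)
  set S := ∑ j, u j with hS
  set T := ∑ j, r j with hT
  set W := ∑ j, u j ^ 2 with hW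
  have hsum : ∑ i, Real.exp (u i) = T + S + l := by
    simp [hT, hS, hr, Finset.sum_sub_distrib]
  have e : ∑ j, u j * (Real.exp (u j) + ∑ i, Real.exp (u i) - (l + 1)) =
      W + ∑ j, u j * r j + S * (T + S) := by
    have e1 : S * (T + S) = ∑ j, u j * (T + S) := by rw [hS, Finset.sum_mul]
    rw [hsum, e1, hW]
    clear_value S T
    rw [← Finset.sum_add_distrib, ← Finset.sum_add_distrib]
    refine Finset.sum_congr rfl fun j _ => ?_
    simp only [hr]; ring
  have hTb : |T| ≤ W := (Finset.abs_sum_le_sum_abs _ _).trans (Finset.sum_le_sum fun j _ => hrb j)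
  have hSb : |S| ≤ l * δ := by
    refine (Finset.abs_sum_le_sum_abs _ _).trans ((Finset.sum_le_sum fun j _ => hu j).trans ?_)
    simp
  have hur : |∑ j, u j * r j| ≤ δ * W := by
    rw [hW, Finset.mul_sum]
    refine (Finset.abs_sum_le_sum_abs _ _).trans (Finset.sum_le_sum fun j _ => ?_)
    rw [abs_mul]
    exact mul_le_mul (hu j) (hrb j) (abs_nonneg _) hδ0.le
  have hST : |S * T| ≤ l * δ * W := by
    rw [abs_mul]
    exact mul_le_mul hSb hTb (abs_nonneg _) (by positivity)
  rw [e]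
  have h1 := (abs_le.1 hur).1
  have h2 := (abs_le.1 hST).1
  have h3 : δ * W + l * δ * W = 1 / 2 * W := by rw [← hδ2]; ring
  have h4 := sq_nonneg S
  have h5 : S * (T + S) = S * T + S ^ 2 := by ring
  linarith

lemma barrier (x : E2) (hx : x ≠ 0) (c : ℝ) (hc : 0 ≤ c) :
    ∃ a b, D2L (fun y => Real.exp (-c * ‖y‖)) x a b ∧
      ∑ i, b i ≤ c ^ 2 * Real.exp (-c * ‖x‖) := by
  have hq : 0 < ‖x‖ := norm_pos_iff.2 hx
  have := fun i => (D2_normsq x 0 0 i).expsqrt c (by simpa using pow_pos hq 2)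
  simp only [zero_smul, add_zero, sub_zero, zero_add, Real.sqrt_sq (norm_nonneg _)] at this
  refine ⟨_, _, this, ?_⟩
  simp only [mul_pow]
  rw [Finset.sum_add_distrib, ← Finset.mul_sum, ← Finset.mul_sum, sum_coord]
  simp only [Finset.sum_const, Finset.card_univ, Fintype.card_fin, nsmul_eq_mul]
  have e : Real.exp (-c * ‖x‖) * (c ^ 2 / (4 * ‖x‖ ^ 2) + c / (4 * ‖x‖ ^ 2 * ‖x‖)) *
      (2 ^ 2 * ‖x‖ ^ 2) + ((2 : ℕ) : ℝ) * (Real.exp (-c * ‖x‖) * (-c * (1 / (2 * ‖x‖))) * 2) =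
      Real.exp (-c * ‖x‖) * (c ^ 2 - c / ‖x‖) := by
    field_simp
    ring
  rw [e]
  have : 0 ≤ c / ‖x‖ := by positivity
  nlinarith [Real.exp_pos (-c * ‖x‖)]

/-- for a planar vortex solution, the fields `u_j = ln f_j + v_j` decay
exponentially: for every `ε ∈ (0,1)` there are `C(ε) > 0` and `R > 0` with
`Σ_i u_i(x)² ≤ C(ε) e^{−(1−ε)‖x‖}` for all `‖x‖ ≥ R`. -/
theorem exponential_decay_of_planar_solution {l : ℕ} (hl : 2 ≤ l)
    (D : PlanarVortexData l) (v : Fin l → E2 → ℝ)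
    (hv : IsPlanarVortexSolution D v) :
    ∀ ε ∈ Set.Ioo (0 : ℝ) 1, ∃ C > (0 : ℝ), ∃ R > (0 : ℝ), ∀ x : E2, R ≤ ‖x‖ →
      ∑ i, (Real.log (D.f i x) + v i x) ^ 2 ≤ C * Real.exp (-(1 - ε) * ‖x‖) := by
  intro ε hε
  obtain ⟨hε0, hε1⟩ := hε
  set c : ℝ := 1 - ε with hc
  have hc0 : 0 < c := by rw [hc]; linarith
  have hc1 : c < 1 := by rw [hc]; linarith
  set u : Fin l → E2 → ℝ := fun j x => Real.log (D.f j x) + v j x with hu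
  have hutend : ∀ j, Tendsto (u j) (cocompact E2) (𝓝 0) := fun j => by
    have := ((f_tendsto D j).log one_ne_zero).add (hv j).2.2
    simpa using this
  set δ : ℝ := 1 / (2 * (l + 1)) with hδ
  have hδ0 : 0 < δ := by positivity
  have hev : ∀ᶠ x in cocompact E2, (∀ j k, x ≠ D.p j k) ∧ (∀ j, |u j x| ≤ δ) := by
    refine Filter.Eventually.and ?_ ?_
    · refine eventually_all.2 fun j => eventually_all.2 fun k => ?_
      exact isCompact_singleton.compl_mem_cocompact
    · refine eventually_all.2 fun j => ?_
      have := (hutend j).abs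
      rw [abs_zero] at this
      exact (this.eventually (gt_mem_nhds hδ0)).mono fun x hx => hx.le
  have toR : ∀ P : E2 → Prop, (∀ᶠ x in cocompact E2, P x) → ∃ R : ℝ, ∀ x, R ≤ ‖x‖ → P x := by
    intro P hP
    rw [← Metric.cobounded_eq_cocompact, ← comap_norm_atTop, eventually_comap,
      eventually_atTop] at hP
    obtain ⟨R, hR⟩ := hP
    exact ⟨R, fun x hx => hR _ hx x rfl⟩
  obtain ⟨R0, hR0⟩ := toR _ hev
  set R := max R0 1 with hRdef
  have hRpos : 0 < R := lt_of_lt_of_le one_pos (le_max_right _ _)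
  have hR : ∀ x : E2, R ≤ ‖x‖ → (∀ j k, x ≠ D.p j k) ∧ (∀ j, |u j x| ≤ δ) := fun x hx =>
    hR0 x ((le_max_left _ _).trans hx)
  set C : ℝ := (l * δ ^ 2 + 1) * Real.exp (c * R) with hC
  have hC0 : 0 < C := by positivity
  refine ⟨C, hC0, R, hRpos, ?_⟩
  set w : E2 → ℝ := fun x => ∑ j, u j x ^ 2 with hw
  set h : E2 → ℝ := fun x => w x + -(C * Real.exp (-c * ‖x‖)) with hh
  have hwtend : Tendsto w (cocompact E2) (𝓝 0) := by
    have : Tendsto w (cocompact E2) (𝓝 (∑ j : Fin l, (0 : ℝ) ^ 2)) :=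
      tendsto_finset_sum _ fun j _ => (hutend j).pow 2
    simpa using this
  have hwR : ∀ x : E2, R ≤ ‖x‖ → w x ≤ l * δ ^ 2 := by
    intro x hx
    have : w x ≤ ∑ j : Fin l, δ ^ 2 := Finset.sum_le_sum fun j _ =>
      sq_le_sq' (abs_le.1 ((hR x hx).2 j)).1 (abs_le.1 ((hR x hx).2 j)).2
    simpa using this
  have hcont : ContinuousOn h {x | R ≤ ‖x‖} := by
    refine ContinuousOn.add ?_ (by fun_prop)
    refine continuousOn_finset_sum _ fun j _ => ContinuousOn.pow (ContinuousOn.add ?_ ?_) 2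
    · exact (f_cont D j).continuousOn.log fun x hx => (f_pos D j ((hR x hx).1 j)).ne'
    · exact (hv j).1.continuous.continuousOn
  by_contra! hcon
  obtain ⟨x1, hx1, hx1'⟩ := hcon
  have hpos : 0 < h x1 := by
    simp only [hh, hw, hu]; linarith
  obtain ⟨R1, hR1⟩ := toR _ (hwtend.eventually (gt_mem_nhds hpos))
  have hK : IsCompact ({x : E2 | R ≤ ‖x‖} ∩ Metric.closedBall 0 (max R1 ‖x1‖)) :=
    (isCompact_closedBall _ _).inter_left (isClosed_le continuous_const continuous_norm)
  obtain ⟨x0, hx0, hmax⟩ := hK.exists_isMaxOn ⟨x1, hx1, by simp⟩ (hcont.mono inter_subset_left)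
  have hx10 : h x1 ≤ h x0 := hmax ⟨hx1, by simp⟩
  have hglob : ∀ x : E2, R ≤ ‖x‖ → h x ≤ h x0 := by
    intro x hx
    by_cases hb : ‖x‖ ≤ max R1 ‖x1‖
    · exact hmax ⟨hx, by simpa using hb⟩
    · have h1 : w x < h x1 := hR1 x ((le_max_left _ _).trans (not_le.1 hb).le)
      have h2 : 0 < C * Real.exp (-c * ‖x‖) := by positivity
      have : h x = w x + -(C * Real.exp (-c * ‖x‖)) := rfl
      linarith
  have hx0R : R ≤ ‖x0‖ := hx0.1
  have hx0pos : 0 < h x0 := hpos.trans_le hx10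
  have hx0lt : R < ‖x0‖ := by
    refine lt_of_le_of_ne hx0R fun heq => ?_
    have h1 := hwR x0 hx0R
    have h2 : C * Real.exp (-c * ‖x0‖) = l * δ ^ 2 + 1 := by
      rw [hC, ← heq, mul_assoc, ← Real.exp_add]
      simp
    have : h x0 = w x0 + -(C * Real.exp (-c * ‖x0‖)) := rfl
    linarith
  have hlocmax : ∀ᶠ y in 𝓝 x0, h y ≤ h x0 := by
    filter_upwards [continuous_norm.continuousAt.eventually (lt_mem_nhds hx0lt)] with y hy
    exact hglob y hy.le
  obtain ⟨hne, hsmall⟩ := hR x0 hx0R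
  have hx0ne : x0 ≠ 0 := norm_pos_iff.1 (hRpos.trans hx0lt)
  -- second derivative data
  choose a b hab hb using fun j => log_f_D2 D j (hne j)
  obtain ⟨p, q, hpq, hq⟩ := barrier x0 hx0ne c hc0.le
  have huD : ∀ j i, D2 (fun t => u j (x0 + t • ee i)) _ _ := fun j i =>
    (hab j i).add (D2_of_contDiff (hv j).1 x0 i)
  have hwD : ∀ i, D2 (fun t => w (x0 + t • ee i)) _ _ := fun i =>
    D2.sum Finset.univ fun j _ => (huD j i).sq
  have hCD : ∀ i, D2 (fun t => C * Real.exp (-c * ‖x0 + t • ee i‖)) _ _ := fun i =>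
    (hpq i).comp (g := fun s => C * s) (g' := fun _ => C) (c := C) (d := 0)
      (Eventually.of_forall fun s => by simpa using (hasDerivAt_id s).const_mul C) rfl
      (hasDerivAt_const _ _)
  have hhD : ∀ i, D2 (fun t => h (x0 + t • ee i)) _ _ := fun i => (hwD i).add (hCD i).neg
  have hle := fun i => (hhD i).nonpos_of_max (by
    have := eventually_line hlocmax i
    simpa [IsLocalMax, IsMaxFilter] using this)
  simp only [zero_smul, add_zero, zero_mul, zero_add] at hle
  have hsum := Finset.sum_nonpos fun i (_ : i ∈ Finset.univ) => hle i
  rw [Finset.sum_add_distrib, Finset.sum_neg_distrib, ← Finset.mul_sum, Finset.sum_comm] at hsum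
  have hlap : ∀ j, ∑ i, (b j i + fderiv ℝ (fun y => fderiv ℝ (v j) y (ee i)) x0 (ee i)) =
      Real.exp (u j x0) + ∑ i, Real.exp (u i x0) - (l + 1) := by
    intro j
    have h1 : ∑ i, fderiv ℝ (fun y => fderiv ℝ (v j) y (ee i)) x0 (ee i) = lap (v j) x0 := rfl
    rw [Finset.sum_add_distrib, hb, h1, (hv j).2.1 x0]
    have h2 : ∀ i, Real.exp (u i x0) = D.f i x0 * Real.exp (v i x0) := fun i => by
      simp only [hu]
      rw [Real.exp_add, Real.exp_log (f_pos D i (hne i))]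
    simp only [h2]
    ring
  have hj : ∀ j, 2 * (u j x0 * (Real.exp (u j x0) + ∑ i, Real.exp (u i x0) - (l + 1))) ≤
      ∑ i, (2 * (a j i + fderiv ℝ (v j) x0 (ee i)) ^ 2 + 2 * u j x0 *
        (b j i + fderiv ℝ (fun y => fderiv ℝ (v j) y (ee i)) x0 (ee i))) := by
    intro j
    rw [Finset.sum_add_distrib, ← Finset.mul_sum, ← Finset.mul_sum, hlap j, ← mul_assoc]
    have : 0 ≤ ∑ i, (a j i + fderiv ℝ (v j) x0 (ee i)) ^ 2 := by positivity
    linarith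
  have hj2 := Finset.sum_le_sum fun j (_ : j ∈ Finset.univ) => hj j
  rw [← Finset.mul_sum] at hj2
  have halg := alg_ineq (fun j => u j x0) hsmall
  have hwx : w x0 = ∑ j, u j x0 ^ 2 := rfl
  have hhx : h x0 = w x0 + -(C * Real.exp (-c * ‖x0‖)) := rfl
  have hexp : 0 < Real.exp (-c * ‖x0‖) := Real.exp_pos _
  have hq2 : C * ∑ i, q i ≤ C * Real.exp (-c * ‖x0‖) := by
    refine mul_le_mul_of_nonneg_left (hq.trans ?_) hC0.le
    exact mul_le_of_le_one_left hexp.le (pow_le_one₀ hc0.le hc1.le)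
  linarith
end
end
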